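/- Let σ > 0, a_t ≠ 0, and 0 < a_e/σ < τ*. Define the rule δ*(x) = exp(2(a_e/σ)·(a_t/(|a_t|σ))·x) / (exp(2(a_e/σ)·(a_t/(|a_t|σ))·x) + 1). Then δ* is minimax optimal for the one-dimensional subproblem: for every measurable rule δ : ℝ → [0,1], sup_{s∈[−1,1]} R_sub(δ,s) ≥ sup_{s∈[−1,1]} R_sub(δ*,s), and sup_{s∈[−1,1]} R_sub(δ*,s) = a_t² ρ(a_e/σ). -/

import Mathlib

open Real MeasureTheory

/-- The standard normal density. -/
noncomputable def gaussPdf (x : ℝ) : ℝ :=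
  (Real.sqrt (2 * Real.pi))⁻¹ * Real.exp (-(x ^ 2) / 2)

/-- ρ(a) = ∫ (1/(exp(2ay)+1))² φ(y−a) dy. -/
noncomputable def ρ (a : ℝ) : ℝ :=
  ∫ y : ℝ, (1 / (Real.exp (2 * a * y) + 1)) ^ 2 * gaussPdf (y - a)

/-- Mean square regret of a rule δ in the one-dimensional subproblem with parameter
s ∈ [−1,1], data X ~ N(s·a_e, σ²), and target effect s·a_t. -/
noncomputable def Rsub (σ aE aT : ℝ) (δ : ℝ → ℝ) (s : ℝ) : ℝ :=
  (s * aT) ^ 2 *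
    ∫ x : ℝ, ((if 0 ≤ s * aT then (1 : ℝ) else 0) - δ x) ^ 2 *
      (σ⁻¹ * gaussPdf ((x - s * aE) / σ))

lemma gaussPdf_eq_gaussianPDFReal (x : ℝ) :
    gaussPdf x = ProbabilityTheory.gaussianPDFReal 0 1 x := by
  simp [gaussPdf, ProbabilityTheory.gaussianPDFReal]

lemma gaussPdf_pos (x : ℝ) : 0 < gaussPdf x := by
  unfold gaussPdf; positivity

lemma gaussPdf_neg (x : ℝ) : gaussPdf (-x) = gaussPdf x := by
  simp [gaussPdf]

@[fun_prop]
lemma continuous_gaussPdf : Continuous gaussPdf := by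
  unfold gaussPdf; fun_prop

lemma integrable_gaussPdf : Integrable gaussPdf := by
  rw [funext gaussPdf_eq_gaussianPDFReal]
  exact ProbabilityTheory.integrable_gaussianPDFReal 0 1

lemma integral_gaussPdf : ∫ x, gaussPdf x = 1 := by
  rw [funext gaussPdf_eq_gaussianPDFReal]
  exact ProbabilityTheory.integral_gaussianPDFReal_eq_one 0 one_ne_zero

lemma integrable_mul_gaussPdf_sub {f : ℝ → ℝ} (hf : Measurable f)
    (h01 : ∀ x, f x ∈ Set.Icc (0 : ℝ) 1) (t : ℝ) :
    Integrable fun y => f y * gaussPdf (y - t) := by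
  refine (integrable_gaussPdf.comp_sub_right t).bdd_mul (c := 1) hf.aestronglyMeasurable ?_
  filter_upwards with y
  rw [Real.norm_eq_abs, abs_of_nonneg (h01 y).1]
  exact (h01 y).2

lemma gaussPdf_mul_sub_gaussPdf_mul_nonneg {y z s t : ℝ} (hyz : y ≤ z) (hst : s ≤ t) :
    0 ≤ gaussPdf (y - s) * gaussPdf (z - t) - gaussPdf (y - t) * gaussPdf (z - s) := by
  have key : rexp (-((y - t) ^ 2) / 2) * rexp (-((z - s) ^ 2) / 2) ≤
      rexp (-((y - s) ^ 2) / 2) * rexp (-((z - t) ^ 2) / 2) := by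
    rw [← Real.exp_add, ← Real.exp_add, Real.exp_le_exp]
    nlinarith [mul_nonneg (sub_nonneg.2 hyz) (sub_nonneg.2 hst)]
  have hc : 0 ≤ ((√(2 * π))⁻¹) ^ 2 := by positivity
  unfold gaussPdf
  nlinarith [mul_le_mul_of_nonneg_left key hc]

/-- The squared loss of the logistic rule with coefficient `a` when treating is optimal. -/
noncomputable def logisticLoss (a y : ℝ) : ℝ := (1 / (rexp (2 * a * y) + 1)) ^ 2

lemma logisticLoss_pos (a y : ℝ) : 0 < logisticLoss a y := by
  unfold logisticLoss; positivity

lemma logisticLoss_mem_Icc (a y : ℝ) : logisticLoss a y ∈ Set.Icc (0 : ℝ) 1 := by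
  refine ⟨(logisticLoss_pos a y).le, ?_⟩
  have h : 1 / (rexp (2 * a * y) + 1) ≤ 1 := by
    rw [div_le_one (by positivity)]
    linarith [Real.exp_pos (2 * a * y)]
  exact pow_le_one₀ (by positivity) h

@[fun_prop]
lemma continuous_logisticLoss (a : ℝ) : Continuous (logisticLoss a) := by
  unfold logisticLoss
  exact (continuous_const.div (by fun_prop) fun y => by positivity).pow 2

lemma logisticLoss_mul_sub_logisticLoss_mul_nonpos {a y z s t : ℝ} (ha : 0 ≤ a)
    (hyz : y ≤ z) (hst : s ≤ t) :
    logisticLoss a (y + s) * logisticLoss a (z + t) -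
      logisticLoss a (y + t) * logisticLoss a (z + s) ≤ 0 := by
  have hX : rexp (2 * a * y) ≤ rexp (2 * a * z) := by gcongr
  have hS : rexp (2 * a * s) ≤ rexp (2 * a * t) := by gcongr
  rw [sub_nonpos]
  unfold logisticLoss
  rw [← mul_pow, ← mul_pow, one_div_mul_one_div, one_div_mul_one_div]
  refine pow_le_pow_left₀ (by positivity) (one_div_le_one_div_of_le (by positivity) ?_) 2
  simp only [mul_add, Real.exp_add]
  nlinarith [mul_nonneg (sub_nonneg.2 hX) (sub_nonneg.2 hS)]

/-- The expected loss of the logistic rule with coefficient `a` at mean `t`. -/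
noncomputable def logisticRisk (a t : ℝ) : ℝ := ∫ y, logisticLoss a y * gaussPdf (y - t)

lemma logisticRisk_self (a : ℝ) : logisticRisk a a = ρ a := rfl

lemma integrable_logisticLoss_add_mul (a s t : ℝ) :
    Integrable fun y => logisticLoss a (y + s) * gaussPdf (y - t) :=
  integrable_mul_gaussPdf_sub (by fun_prop) (fun _ => logisticLoss_mem_Icc _ _) t

lemma logisticRisk_add (a s t : ℝ) :
    logisticRisk a (s + t) = ∫ y, logisticLoss a (y + s) * gaussPdf (y - t) := by
  rw [logisticRisk,
    ← integral_add_right_eq_self (fun y => logisticLoss a y * gaussPdf (y - (s + t))) s]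
  congr! 4
  ring

lemma logisticRisk_pos (a t : ℝ) : 0 < logisticRisk a t := by
  have hi := integrable_logisticLoss_add_mul a 0 t
  simp only [add_zero] at hi
  have hp : ∀ y, 0 < logisticLoss a y * gaussPdf (y - t) :=
    fun y => mul_pos (logisticLoss_pos a y) (gaussPdf_pos _)
  have hsupp : (Function.support fun y => logisticLoss a y * gaussPdf (y - t)) = Set.univ :=
    Set.eq_univ_of_forall fun y => (hp y).ne'
  rw [logisticRisk, integral_pos_iff_support_of_nonneg (fun y => (hp y).le) hi, hsupp]
  simp

lemma continuous_logisticRisk (a : ℝ) : Continuous (logisticRisk a) := by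
  have h : logisticRisk a = fun t => ∫ y, logisticLoss a (y + t) * gaussPdf y := by
    funext t
    simpa using logisticRisk_add a t 0
  rw [h]
  refine continuous_of_dominated (bound := gaussPdf) (fun t => ?_) (fun t => ?_)
    integrable_gaussPdf ?_
  · exact Continuous.aestronglyMeasurable (by fun_prop)
  · filter_upwards with y
    have h := logisticLoss_mem_Icc a (y + t)
    rw [Real.norm_eq_abs, abs_of_nonneg (mul_nonneg h.1 (gaussPdf_pos y).le)]
    exact mul_le_of_le_one_left (gaussPdf_pos y).le h.2
  · filter_upwards with y
    fun_prop

/-- The expected loss is midpoint log-concave in the mean. -/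
lemma logisticRisk_mul_le_sq {a d : ℝ} (m : ℝ) (ha : 0 ≤ a) (hd : 0 ≤ d) :
    logisticRisk a (m - d) * logisticRisk a (m + d) ≤ logisticRisk a m ^ 2 := by
  set f : ℝ → ℝ → ℝ → ℝ := fun s t y => logisticLoss a (y + s) * gaussPdf (y - t) with hf
  have hprod : ∀ s t s' t', Integrable (fun p : ℝ × ℝ => f s t p.1 * f s' t' p.2)
      (volume.prod volume) := fun s t s' t' =>
    (integrable_logisticLoss_add_mul a s t).mul_prod (integrable_logisticLoss_add_mul a s' t')
  have hval : ∀ s t s' t', ∫ p : ℝ × ℝ, f s t p.1 * f s' t' p.2 ∂(volume.prod volume) =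
      logisticRisk a (s + t) * logisticRisk a (s' + t') := fun s t s' t' => by
    rw [integral_prod_mul, logisticRisk_add, logisticRisk_add]
  have hle := integral_mono
    ((hprod (m - d / 2) (-(d / 2)) (m + d / 2) (d / 2)).add
      (hprod (m + d / 2) (d / 2) (m - d / 2) (-(d / 2))))
    ((hprod (m - d / 2) (d / 2) (m + d / 2) (-(d / 2))).add
      (hprod (m + d / 2) (-(d / 2)) (m - d / 2) (d / 2)))
    (fun p => by
      have hst : -(d / 2) ≤ d / 2 := by linarith
      have hst' : m - d / 2 ≤ m + d / 2 := by linarith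
      simp only [Pi.add_apply, hf]
      rcases le_total p.1 p.2 with h | h
      · nlinarith [mul_nonneg (gaussPdf_mul_sub_gaussPdf_mul_nonneg h hst)
          (neg_nonneg.2 (logisticLoss_mul_sub_logisticLoss_mul_nonpos ha h hst'))]
      · nlinarith [mul_nonneg (gaussPdf_mul_sub_gaussPdf_mul_nonneg h hst)
          (neg_nonneg.2 (logisticLoss_mul_sub_logisticLoss_mul_nonpos ha h hst'))])
  simp only [Pi.add_apply] at hle
  rw [integral_add (hprod _ _ _ _) (hprod _ _ _ _), integral_add (hprod _ _ _ _) (hprod _ _ _ _),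
    hval, hval, hval, hval] at hle
  have e1 : m - d / 2 + -(d / 2) = m - d := by ring
  have e2 : m + d / 2 + d / 2 = m + d := by ring
  have e3 : m - d / 2 + d / 2 = m := by ring
  have e4 : m + d / 2 + -(d / 2) = m := by ring
  rw [e1, e2, e3, e4] at hle
  nlinarith

lemma sq_mul_logisticRisk_mul_lt {a m d : ℝ} (ha : 0 ≤ a) (hd : 0 < d) (hdm : d < m) :
    ((m - d) ^ 2 * logisticRisk a (m - d)) * ((m + d) ^ 2 * logisticRisk a (m + d)) <
      (m ^ 2 * logisticRisk a m) ^ 2 := by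
  have h := logisticRisk_mul_le_sq m ha hd.le
  have hpos := pow_pos (logisticRisk_pos a m) 2
  have hlt : ((m - d) * (m + d)) ^ 2 < (m ^ 2) ^ 2 :=
    pow_lt_pow_left₀ (by nlinarith) (mul_nonneg (by linarith) (by linarith)) two_ne_zero
  calc _ = ((m - d) * (m + d)) ^ 2 * (logisticRisk a (m - d) * logisticRisk a (m + d)) := by ring
    _ ≤ ((m - d) * (m + d)) ^ 2 * logisticRisk a m ^ 2 := by gcongr
    _ < (m ^ 2) ^ 2 * logisticRisk a m ^ 2 := by gcongr
    _ = _ := by ring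

/-- A continuous nonnegative function that is strictly midpoint log-concave on an interval exceeds
the smaller of its endpoint values at every interior point. -/
lemma min_endpoints_lt_of_mul_lt_sq {h : ℝ → ℝ} {u v x : ℝ} (hux : u < x) (hxv : x < v)
    (hc : ContinuousOn h (Set.Icc u v)) (h0 : ∀ t ∈ Set.Icc u v, 0 ≤ h t)
    (hmid : ∀ m d, 0 < d → u ≤ m - d → m + d ≤ v → h (m - d) * h (m + d) < h m ^ 2) :
    min (h u) (h v) < h x := by
  have hnot : ∀ m, u < m → m < v → ¬ ∀ t ∈ Set.Icc u v, h m ≤ h t := by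
    intro m hum hmv hmin
    set d := min (m - u) (v - m)
    have hd : 0 < d := lt_min (by linarith) (by linarith)
    have hd1 : d ≤ m - u := min_le_left _ _
    have hd2 : d ≤ v - m := min_le_right _ _
    have h1 := hmin (m - d) ⟨by linarith, by linarith⟩
    have h2 := hmin (m + d) ⟨by linarith, by linarith⟩
    have h3 := hmid m d hd (by linarith) (by linarith)
    have h4 := h0 m ⟨hum.le, hmv.le⟩
    nlinarith [mul_le_mul h1 h2 h4 (h4.trans h1)]
  obtain ⟨m, hm, hmin⟩ :=
    isCompact_Icc.exists_isMinOn (Set.nonempty_Icc.2 (hux.trans hxv).le) hc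
  have hmin' : ∀ t ∈ Set.Icc u v, h m ≤ h t := fun t ht => hmin ht
  by_contra! hcon
  refine hnot x hux hxv fun t ht => le_trans ?_ (hmin' t ht)
  rcases hm.1.eq_or_lt with rfl | hm1
  · exact hcon.trans (min_le_left _ _)
  rcases hm.2.eq_or_lt with rfl | hm2
  · exact hcon.trans (min_le_right _ _)
  · exact absurd hmin' (hnot m hm1 hm2)

lemma one_sub_sq_logistic (a y : ℝ) :
    (1 - rexp (2 * a * y) / (rexp (2 * a * y) + 1)) ^ 2 = logisticLoss a y := by
  have : rexp (2 * a * y) + 1 ≠ 0 := by positivity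
  unfold logisticLoss
  congr 1
  field_simp
  ring

lemma sq_logistic (a y : ℝ) :
    (rexp (2 * a * y) / (rexp (2 * a * y) + 1)) ^ 2 = logisticLoss a (-y) := by
  have h : rexp (2 * a * -y) = (rexp (2 * a * y))⁻¹ := by
    rw [← Real.exp_neg]; ring_nf
  have h0 := Real.exp_pos (2 * a * y)
  unfold logisticLoss
  rw [h]
  congr 1
  field_simp
  ring

lemma integral_sq_logistic_mul (a t : ℝ) :
    ∫ y, (rexp (2 * a * y) / (rexp (2 * a * y) + 1)) ^ 2 * gaussPdf (y - t) =
      logisticRisk a (-t) := by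
  rw [logisticRisk,
    ← integral_neg_eq_self (fun y => logisticLoss a y * gaussPdf (y - -t))]
  refine integral_congr_ae (.of_forall fun y => ?_)
  simp only [sq_logistic]
  rw [← gaussPdf_neg (y - t), show -(y - t) = -y - -t by ring]

lemma logistic_mem_Icc (x : ℝ) : rexp x / (rexp x + 1) ∈ Set.Icc (0 : ℝ) 1 :=
  ⟨by positivity, by rw [div_le_one (by positivity)]; linarith⟩

lemma measurable_logistic (a : ℝ) :
    Measurable fun y => rexp (2 * a * y) / (rexp (2 * a * y) + 1) := by
  fun_prop

lemma sq_mem_Icc {x : ℝ} (h : x ∈ Set.Icc (0 : ℝ) 1) : x ^ 2 ∈ Set.Icc (0 : ℝ) 1 :=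
  ⟨sq_nonneg x, pow_le_one₀ h.1 h.2⟩

lemma one_sub_sq_mem_Icc {x : ℝ} (h : x ∈ Set.Icc (0 : ℝ) 1) :
    (1 - x) ^ 2 ∈ Set.Icc (0 : ℝ) 1 :=
  sq_mem_Icc ⟨by linarith [h.2], by linarith [h.1]⟩

/-- The logistic rule is Bayes against the uniform prior on `{t, -t}`. -/
lemma two_mul_rho_le {δ : ℝ → ℝ} (hδ : Measurable δ) (h01 : ∀ x, δ x ∈ Set.Icc (0 : ℝ) 1)
    (t : ℝ) :
    2 * ρ t ≤ (∫ y, (1 - δ y) ^ 2 * gaussPdf (y - t)) + ∫ y, (δ y) ^ 2 * gaussPdf (y - -t) := by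
  set L : ℝ → ℝ := fun y => rexp (2 * t * y) / (rexp (2 * t * y) + 1) with hL
  have hLm : Measurable L := measurable_logistic t
  have hL01 : ∀ y, L y ∈ Set.Icc (0 : ℝ) 1 := fun y => logistic_mem_Icc _
  have h1 : ρ t = ∫ y, (1 - L y) ^ 2 * gaussPdf (y - t) := by
    simp only [hL, one_sub_sq_logistic]; rfl
  have h2 : ρ t = ∫ y, (L y) ^ 2 * gaussPdf (y - -t) := by
    rw [integral_sq_logistic_mul, neg_neg, logisticRisk_self]
  have hi1 : ∀ {η : ℝ → ℝ}, Measurable η → (∀ x, η x ∈ Set.Icc (0 : ℝ) 1) →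
      Integrable fun y => (1 - η y) ^ 2 * gaussPdf (y - t) := fun hm hη =>
    integrable_mul_gaussPdf_sub (by fun_prop) (fun x => one_sub_sq_mem_Icc (hη x)) t
  have hi2 : ∀ {η : ℝ → ℝ}, Measurable η → (∀ x, η x ∈ Set.Icc (0 : ℝ) 1) →
      Integrable fun y => (η y) ^ 2 * gaussPdf (y - -t) := fun hm hη =>
    integrable_mul_gaussPdf_sub (by fun_prop) (fun x => sq_mem_Icc (hη x)) (-t)
  rw [two_mul]
  nth_rewrite 1 [h1]
  rw [h2, ← integral_add (hi1 hLm hL01) (hi2 hLm hL01), ← integral_add (hi1 hδ h01) (hi2 hδ h01)]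
  refine integral_mono ((hi1 hLm hL01).add (hi2 hLm hL01)) ((hi1 hδ h01).add (hi2 hδ h01))
    fun y => ?_
  have hq := gaussPdf_pos (y - -t)
  have hp : gaussPdf (y - t) = rexp (2 * t * y) * gaussPdf (y - -t) := by
    unfold gaussPdf
    rw [mul_left_comm, ← Real.exp_add]
    ring_nf
  have hE := Real.exp_pos (2 * t * y)
  have hLE : L y * (rexp (2 * t * y) + 1) = rexp (2 * t * y) := by
    simp only [hL]; field_simp
  simp only [hp]
  set E := rexp (2 * t * y)
  have hdiff : ((1 - δ y) ^ 2 * E + δ y ^ 2) - ((1 - L y) ^ 2 * E + L y ^ 2) =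
      (E + 1) * (δ y - L y) ^ 2 := by
    linear_combination (2 * (δ y - L y)) * hLE
  have : 0 ≤ (E + 1) * (δ y - L y) ^ 2 := by positivity
  nlinarith

/-- Regret in the problem rescaled to unit variance and unit effect. -/
noncomputable def unitRegret (a : ℝ) (δ : ℝ → ℝ) (s : ℝ) : ℝ :=
  s ^ 2 * ∫ y, ((if 0 ≤ s then (1 : ℝ) else 0) - δ y) ^ 2 * gaussPdf (y - s * a)

lemma Rsub_eq_unitRegret {σ aE aT : ℝ} (hσ : 0 < σ) (haT : aT ≠ 0) (δ : ℝ → ℝ) (s : ℝ) :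
    Rsub σ aE aT δ s =
      aT ^ 2 * unitRegret (aE / σ) (fun y => δ (aT / |aT| * σ * y)) (aT / |aT| * s) := by
  have habs : 0 < |aT| := abs_pos.2 haT
  set ε := aT / |aT| with hε
  have hεε : ε = 1 ∨ ε = -1 := by
    rcases abs_choice aT with h | h
    · left; rw [hε, h]; field_simp
    · right; rw [hε, h]; field_simp
  have haε : aT = ε * |aT| := by rw [hε]; field_simp
  have hε2 : ε ^ 2 = 1 := by rcases hεε with h | h <;> rw [h] <;> norm_num
  have hsign : 0 ≤ s * aT ↔ 0 ≤ ε * s := by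
    rw [show s * aT = ε * s * |aT| by nth_rewrite 1 [haε]; ring]
    exact mul_nonneg_iff_of_pos_right habs
  have habsε : |ε * σ| = σ := by
    rcases hεε with h | h <;> rw [h] <;> simp [abs_of_pos hσ]
  unfold Rsub unitRegret
  simp only [hsign]
  set I : ℝ := if 0 ≤ ε * s then 1 else 0
  have hcv := Measure.integral_comp_mul_left
    (fun x => (I - δ x) ^ 2 * (σ⁻¹ * gaussPdf ((x - s * aE) / σ))) (ε * σ)
  rw [abs_inv, habsε, smul_eq_mul, eq_inv_mul_iff_mul_eq₀ hσ.ne'] at hcv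
  rw [← hcv, mul_pow, mul_pow, hε2, one_mul, mul_assoc, mul_left_comm]
  congr 2
  rw [← integral_const_mul]
  refine integral_congr_ae (.of_forall fun y => ?_)
  have hg : gaussPdf ((ε * σ * y - s * aE) / σ) = gaussPdf (y - ε * s * (aE / σ)) := by
    have : (ε * σ * y - s * aE) / σ = ε * y - s * (aE / σ) := by field_simp
    rw [this]
    rcases hεε with h | h <;> rw [h]
    · simp
    · rw [← gaussPdf_neg]; congr 1; ring
  simp only [hg]
  field_simp

lemma unitRegret_le_one {a : ℝ} {δ : ℝ → ℝ} (hδ : Measurable δ)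
    (h01 : ∀ x, δ x ∈ Set.Icc (0 : ℝ) 1) {s : ℝ} (hs : s ∈ Set.Icc (-1 : ℝ) 1) :
    unitRegret a δ s ≤ 1 := by
  have hs2 : s ^ 2 ≤ 1 := by nlinarith [hs.1, hs.2]
  have hmem : ∀ y, ((if 0 ≤ s then (1 : ℝ) else 0) - δ y) ^ 2 ∈ Set.Icc (0 : ℝ) 1 := fun y => by
    split_ifs
    · exact one_sub_sq_mem_Icc (h01 y)
    · simpa using sq_mem_Icc (h01 y)
  have hprod : ∫ y, ((if 0 ≤ s then (1 : ℝ) else 0) - δ y) ^ 2 * gaussPdf (y - s * a) ≤ 1 := by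
    have := integral_mono (integrable_mul_gaussPdf_sub (by fun_prop) hmem (s * a))
      (integrable_gaussPdf.comp_sub_right (s * a))
      (fun y => mul_le_of_le_one_left (gaussPdf_pos _).le (hmem y).2)
    rwa [integral_sub_right_eq_self gaussPdf, integral_gaussPdf] at this
  have h0 : 0 ≤ ∫ y, ((if 0 ≤ s then (1 : ℝ) else 0) - δ y) ^ 2 * gaussPdf (y - s * a) :=
    integral_nonneg fun y => mul_nonneg (hmem y).1 (gaussPdf_pos _).le
  exact mul_le_one₀ hs2 h0 hprod

lemma unitRegret_logistic (a s : ℝ) :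
    unitRegret a (fun y => rexp (2 * a * y) / (rexp (2 * a * y) + 1)) s =
      s ^ 2 * logisticRisk a (|s| * a) := by
  unfold unitRegret
  congr 1
  rcases le_or_gt 0 s with h | h
  · simp only [h, if_true, one_sub_sq_logistic, abs_of_nonneg h]
    rfl
  · simp only [not_le.2 h, if_false, zero_sub, neg_sq, abs_of_neg h, integral_sq_logistic_mul,
      neg_mul]

/-- Below a maximizer of `τ ^ 2 * ρ τ`, the worst-case regret of the logistic rule is attained at
the largest admissible effect. -/
lemma sq_mul_logisticRisk_le {a τstar r : ℝ}
    (hτmax : ∀ τ : ℝ, 0 ≤ τ → τ ^ 2 * ρ τ ≤ τstar ^ 2 * ρ τstar)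
    (ha : 0 < a) (haτ : a < τstar) (hr0 : 0 ≤ r) (hr1 : r ≤ 1) :
    r ^ 2 * logisticRisk a (r * a) ≤ ρ a := by
  rcases hr0.eq_or_lt with rfl | hr0
  · simpa [logisticRisk_self] using (logisticRisk_pos a a).le
  rcases hr1.eq_or_lt with rfl | hr1
  · simp [logisticRisk_self]
  by_contra! hcon
  have hra : 0 < r * a := mul_pos hr0 ha
  have hmin := min_endpoints_lt_of_mul_lt_sq (h := fun t => t ^ 2 * logisticRisk a t) (u := r * a)
    (v := τstar) (x := a) (by nlinarith) haτ
    (((continuous_id.pow 2).mul (continuous_logisticRisk a)).continuousOn)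
    (fun t _ => mul_nonneg (sq_nonneg t) (logisticRisk_pos a t).le)
    (fun m d hd hu _ => sq_mul_logisticRisk_mul_lt ha.le hd (by linarith))
  have hbayes := two_mul_rho_le (measurable_logistic a) (fun _ => logistic_mem_Icc _) τstar
  simp only [one_sub_sq_logistic] at hbayes
  rw [integral_sq_logistic_mul, neg_neg] at hbayes
  change 2 * ρ τstar ≤ logisticRisk a τstar + logisticRisk a τstar at hbayes
  have hmax := hτmax a ha.le
  rcases min_lt_iff.1 hmin with h | h
  · simp only [logisticRisk_self] at h
    nlinarith [mul_lt_mul_of_pos_left hcon (pow_pos ha 2)]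
  · simp only [logisticRisk_self] at h
    nlinarith [mul_le_mul_of_nonneg_left hbayes (sq_nonneg τstar)]

/-- For 0 < a_e/σ < τ*, the logistic rule with coefficient a_e/σ is minimax optimal for
the one-dimensional subproblem, with worst-case regret a_t²ρ(a_e/σ). -/
theorem stmt_5 (σ aE aT τstar : ℝ) (hσ : 0 < σ) (haT : aT ≠ 0)
    (hτ0 : 0 ≤ τstar)
    (hτmax : ∀ τ : ℝ, 0 ≤ τ → τ ^ 2 * ρ τ ≤ τstar ^ 2 * ρ τstar)
    (hratio0 : 0 < aE / σ) (hratio : aE / σ < τstar)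
    (δstar : ℝ → ℝ)
    (hδstar : ∀ x, δstar x =
      Real.exp (2 * (aE / σ) * (aT / (|aT| * σ)) * x) /
        (Real.exp (2 * (aE / σ) * (aT / (|aT| * σ)) * x) + 1)) :
    (∀ δ : ℝ → ℝ, Measurable δ → (∀ x, δ x ∈ Set.Icc (0 : ℝ) 1) →
      (⨆ s : Set.Icc (-1 : ℝ) 1, Rsub σ aE aT δstar s) ≤
        ⨆ s : Set.Icc (-1 : ℝ) 1, Rsub σ aE aT δ s) ∧
    (⨆ s : Set.Icc (-1 : ℝ) 1, Rsub σ aE aT δstar s) = aT ^ 2 * ρ (aE / σ) := by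
  set a := aE / σ with ha
  set ε := aT / |aT| with hε
  have habs : 0 < |aT| := abs_pos.2 haT
  have hεε : ε = 1 ∨ ε = -1 := by
    rcases abs_choice aT with h | h
    · left; rw [hε, h]; field_simp
    · right; rw [hε, h]; field_simp
  have hε2 : ε ^ 2 = 1 := by rcases hεε with h | h <;> rw [h] <;> norm_num
  have hmem : ∀ s ∈ Set.Icc (-1 : ℝ) 1, ε * s ∈ Set.Icc (-1 : ℝ) 1 := fun s hs => by
    rcases hεε with h | h <;> rw [h]
    · simpa using hs
    · exact ⟨by linarith [hs.2], by linarith [hs.1]⟩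
  have hεmem : ε ∈ Set.Icc (-1 : ℝ) 1 := by simpa using hmem 1 (by simp)
  have hεmem' : -ε ∈ Set.Icc (-1 : ℝ) 1 := by simpa using hmem (-1) (by simp)
  have hbdd : ∀ δ : ℝ → ℝ, Measurable δ → (∀ x, δ x ∈ Set.Icc (0 : ℝ) 1) →
      BddAbove (Set.range fun s : Set.Icc (-1 : ℝ) 1 => Rsub σ aE aT δ s) := by
    rintro δ hδ h01
    refine ⟨aT ^ 2, ?_⟩
    rintro _ ⟨s, rfl⟩
    simp only [Rsub_eq_unitRegret hσ haT δ]
    exact mul_le_of_le_one_right (sq_nonneg _)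
      (unitRegret_le_one (by fun_prop) (fun x => h01 _) (hmem s s.2))
  have hlower : ∀ δ : ℝ → ℝ, Measurable δ → (∀ x, δ x ∈ Set.Icc (0 : ℝ) 1) →
      aT ^ 2 * ρ a ≤ ⨆ s : Set.Icc (-1 : ℝ) 1, Rsub σ aE aT δ s := by
    intro δ hδ h01
    have h1 := le_ciSup (hbdd δ hδ h01) ⟨ε, hεmem⟩
    have h2 := le_ciSup (hbdd δ hδ h01) ⟨-ε, hεmem'⟩
    have hb := two_mul_rho_le (δ := fun y => δ (ε * σ * y)) (by fun_prop) (fun x => h01 _) a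
    rw [Rsub_eq_unitRegret hσ haT δ, ← hε, ← ha] at h1 h2
    rw [show ε * ε = 1 by rw [← sq, hε2]] at h1
    rw [show ε * -ε = -1 by rw [mul_neg, ← sq, hε2]] at h2
    simp only [unitRegret, zero_le_one, if_true, one_pow, one_mul] at h1
    simp only [unitRegret, show ¬ (0 : ℝ) ≤ -1 by norm_num, if_false, zero_sub, neg_sq, one_pow,
      one_mul, neg_mul] at h2
    nlinarith [mul_le_mul_of_nonneg_left hb (sq_nonneg aT)]
  have hsup : (⨆ s : Set.Icc (-1 : ℝ) 1, Rsub σ aE aT δstar s) = aT ^ 2 * ρ a := by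
    have hδ : δstar = fun x => rexp (2 * a * (aT / (|aT| * σ)) * x) /
        (rexp (2 * a * (aT / (|aT| * σ)) * x) + 1) := funext hδstar
    refine le_antisymm ?_ (hlower δstar ?_ ?_)
    · have : Nonempty (Set.Icc (-1 : ℝ) 1) := ⟨⟨ε, hεmem⟩⟩
      refine ciSup_le fun s => ?_
      have hscale : (fun y => δstar (ε * σ * y)) =
          fun y => rexp (2 * a * y) / (rexp (2 * a * y) + 1) := by
        funext y
        have : 2 * a * (aT / (|aT| * σ)) * (ε * σ * y) = 2 * a * y := by
          rw [show aT / (|aT| * σ) = ε / σ by rw [hε, div_div]]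
          calc _ = 2 * a * y * ε ^ 2 * (σ / σ) := by ring
            _ = _ := by rw [hε2, div_self hσ.ne']; ring
        rw [hδstar, this]
      rw [Rsub_eq_unitRegret hσ haT, ← hε, ← ha, hscale, unitRegret_logistic]
      have hs := hmem s s.2
      rw [← sq_abs (ε * s)]
      gcongr
      exact sq_mul_logisticRisk_le hτmax hratio0 hratio (abs_nonneg _) (abs_le.2 hs)
    · rw [hδ]; fun_prop
    · intro x
      rw [hδ]
      exact logistic_mem_Icc _
  exact ⟨fun δ hδ h01 => hsup ▸ hlower δ hδ h01, hsup⟩
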